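/- Fix q ∈ (0,2], β ∈ (0,∞) and α ∈ (1,∞), and set β_q := β^{2/q} and α_q := 2α/q. Let (λ_{ij})_{i,j∈ℤ} be i.i.d. random variables distributed according to the measure μ_q (the Gaussian mixing measure of the potential e^{−|x|^q}), with law P_q and expectation E_q. Then for every integer N ≥ 1, the variance of the height at the origin under the discrete q-SOS long-range chain dominates the annealed variance of the quenched Gaussian long-range chain: Var^{q-SOS}_{N,β,α}[φ(0)] ≥ E_q[ Var^λ_{N,β_q,α_q}[φ(0)] ]. -/

import Mathlib

noncomputable section

/-- Configurations of the long-range chain of length `N`: integer-valued height functions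
on `ℤ` vanishing outside `{-N, …, N}`. -/
def ChainConfig (N : ℕ) : Type :=
  {φ : ℤ → ℤ // ∀ k : ℤ, (N : ℤ) < |k| → φ k = 0}

/-- Energy `β ∑_{i ≠ j} |φ(i) − φ(j)|^q / |i − j|^α` of a configuration of the long-range
chain with potential exponent `q` and range exponent `α`. -/
def chainEnergy (β α q : ℝ) (φ : ℤ → ℤ) : ℝ :=
  β * ∑' p : ℤ × ℤ,
      if p.1 = p.2 then 0
      else |((φ p.1 - φ p.2 : ℤ) : ℝ)| ^ q / |((p.1 - p.2 : ℤ) : ℝ)| ^ α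

/-- Boltzmann weight of a configuration. -/
def chainWeight (β α q : ℝ) (φ : ℤ → ℤ) : ℝ :=
  Real.exp (-chainEnergy β α q φ)

/-- Partition function of the long-range chain. -/
def chainZ (N : ℕ) (β α q : ℝ) : ℝ :=
  ∑' φ : ChainConfig N, chainWeight β α q φ.val

/-- Mean of the height at the origin. -/
def chainMean (N : ℕ) (β α q : ℝ) : ℝ :=
  (∑' φ : ChainConfig N, ((φ.val 0 : ℤ) : ℝ) * chainWeight β α q φ.val) / chainZ N β α q

/-- Variance of the height at the origin under the long-range chain `μ_{N,β,α}`
(with potential exponent `q`; `q = 2` is the discrete Gaussian chain,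
`q ∈ (0,2)` the `q`-SOS chain). -/
def chainVar (N : ℕ) (β α q : ℝ) : ℝ :=
  (∑' φ : ChainConfig N, ((φ.val 0 : ℤ) : ℝ) ^ 2 * chainWeight β α q φ.val) / chainZ N β α q
    - chainMean N β α q ^ 2

end

noncomputable section

/-- Energy of a configuration of the Gaussian long-range chain equipped with
conductances `lam = (λ_{ij})_{i,j∈ℤ}`:
`β ∑_{i ≠ j} λ_{ij} (φ(i) − φ(j))² / |i − j|^α`. -/
def qchainEnergy (β α : ℝ) (lam : ℤ × ℤ → ℝ) (φ : ℤ → ℤ) : ℝ :=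
  β * ∑' p : ℤ × ℤ,
      if p.1 = p.2 then 0
      else lam p * ((φ p.1 - φ p.2 : ℤ) : ℝ) ^ 2 / |((p.1 - p.2 : ℤ) : ℝ)| ^ α

/-- Boltzmann weight of a configuration of the quenched Gaussian chain. -/
def qchainWeight (β α : ℝ) (lam : ℤ × ℤ → ℝ) (φ : ℤ → ℤ) : ℝ :=
  Real.exp (-qchainEnergy β α lam φ)

/-- Partition function of the quenched Gaussian chain. -/
def qchainZ (N : ℕ) (β α : ℝ) (lam : ℤ × ℤ → ℝ) : ℝ :=
  ∑' φ : ChainConfig N, qchainWeight β α lam φ.val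

/-- Mean of the height at the origin under the quenched Gaussian chain. -/
def qchainMean (N : ℕ) (β α : ℝ) (lam : ℤ × ℤ → ℝ) : ℝ :=
  (∑' φ : ChainConfig N, ((φ.val 0 : ℤ) : ℝ) * qchainWeight β α lam φ.val) /
    qchainZ N β α lam

/-- Variance `Var^λ_{N,β,α}[φ(0)]` of the height at the origin under the Gaussian
long-range chain with conductances `lam`. -/
def qchainVar (N : ℕ) (β α : ℝ) (lam : ℤ × ℤ → ℝ) : ℝ :=
  (∑' φ : ChainConfig N, ((φ.val 0 : ℤ) : ℝ) ^ 2 * qchainWeight β α lam φ.val) /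
      qchainZ N β α lam
    - qchainMean N β α lam ^ 2

end

section GinibreInequality

open Real Filter Topology

/-- The kernel `(u, v) ↦ 1_{cl u = cl v} b(u) b(v) sinh(s d(u) d(v))` is positive semidefinite. -/
theorem sum_sinh_kernel_nonneg {L K : Type*} [DecidableEq K] (cl : L → K) (b d : L → ℝ) {s : ℝ}
    (hs : 0 ≤ s) (F : Finset L) :
    0 ≤ ∑ p ∈ F ×ˢ F,
      if cl p.1 = cl p.2 then b p.1 * b p.2 * sinh (s * (d p.1 * d p.2)) else 0 := by
  have key (g : L → ℝ) :
      0 ≤ ∑ p ∈ F ×ˢ F, if cl p.1 = cl p.2 then g p.1 * g p.2 else 0 := by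
    have h : ∑ p ∈ F ×ˢ F, (if cl p.1 = cl p.2 then g p.1 * g p.2 else 0) =
        ∑ c ∈ F.image cl, (∑ u ∈ F, if cl u = c then g u else 0) ^ 2 := by
      simp_rw [sq, Finset.sum_mul_sum, Finset.sum_product]
      rw [Finset.sum_comm' (t' := F) (s' := fun _ ↦ F.image cl) (by simp [and_comm])]
      refine Finset.sum_congr rfl fun u hu ↦ ?_
      rw [Finset.sum_comm]
      refine Finset.sum_congr rfl fun v hv ↦ ?_
      rw [Finset.sum_eq_single (cl u)]
      · by_cases huv : cl u = cl v
        · simp [huv]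
        · simp [huv, Ne.symm huv]
      · intro c _ hc
        simp [Ne.symm hc]
      · intro hc
        exact absurd (Finset.mem_image_of_mem cl hu) hc
    rw [h]
    positivity
  have hsum : HasSum (fun n : ℕ ↦ ∑ p ∈ F ×ˢ F,
      if cl p.1 = cl p.2 then
        b p.1 * b p.2 * ((s * (d p.1 * d p.2)) ^ (2 * n + 1) / ((2 * n + 1).factorial : ℝ)) else 0)
      (∑ p ∈ F ×ˢ F,
        if cl p.1 = cl p.2 then b p.1 * b p.2 * sinh (s * (d p.1 * d p.2)) else 0) := by
    refine hasSum_sum fun p _ ↦ ?_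
    split_ifs
    · exact (hasSum_sinh _).mul_left _
    · exact hasSum_zero
  refine hsum.nonneg fun n ↦ ?_
  have h := mul_nonneg (div_nonneg (pow_nonneg hs (2 * n + 1))
    (Nat.cast_nonneg (2 * n + 1).factorial)) (key fun u ↦ b u * d u ^ (2 * n + 1))
  rw [Finset.mul_sum] at h
  refine h.trans_eq (Finset.sum_congr rfl fun p _ ↦ ?_)
  split_ifs
  · rw [mul_pow, mul_pow]; ring
  · simp

theorem tsum_nonneg_of_sum_product_nonneg {L : Type*} {f : L × L → ℝ} (hf : Summable f)
    (h : ∀ F : Finset L, 0 ≤ ∑ p ∈ F ×ˢ F, f p) : 0 ≤ ∑' p, f p := by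
  have ht : Tendsto (fun F : Finset L ↦ F ×ˢ F) atTop atTop := by
    classical
    refine tendsto_atTop_atTop.2 fun S ↦ ⟨S.image Prod.fst ∪ S.image Prod.snd, fun F hF ↦ ?_⟩
    intro p hp
    exact Finset.mem_product.2 ⟨hF (Finset.mem_union_left _ (Finset.mem_image_of_mem _ hp)),
      hF (Finset.mem_union_right _ (Finset.mem_image_of_mem _ hp))⟩
  exact ge_of_tendsto' (hf.hasSum.comp ht) h

/-- Correlation inequality for discrete Gaussian measures: adding a nonnegative square `r D²` to
the energy decreases the second moment of a linear observable. -/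
theorem second_moment_antitone {L : Type*} [AddCommGroup L]
    (h2 : ∀ u : L, u + u = 0 → u = 0) (X D : L →+ ℝ) (Q : L → ℝ)
    (hQ : ∀ u v, Q (u + v) + Q (u - v) = 2 * Q u + 2 * Q v) {r : ℝ} (hr : 0 ≤ r)
    (hw : Summable fun u ↦ exp (-Q u)) (hX : Summable fun u ↦ X u ^ 2 * exp (-Q u)) :
    (∑' u, X u ^ 2 * exp (-(Q u + r * D u ^ 2))) * ∑' u, exp (-Q u) ≤
      (∑' u, X u ^ 2 * exp (-Q u)) * ∑' u, exp (-(Q u + r * D u ^ 2)) := by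
  classical
  have hle (u : L) : exp (-(Q u + r * D u ^ 2)) ≤ exp (-Q u) :=
    exp_le_exp.2 (by nlinarith [mul_nonneg hr (sq_nonneg (D u))])
  have hw' : Summable fun u ↦ exp (-(Q u + r * D u ^ 2)) :=
    hw.of_nonneg_of_le (fun _ ↦ (exp_pos _).le) hle
  have hX' : Summable fun u ↦ X u ^ 2 * exp (-(Q u + r * D u ^ 2)) :=
    hX.of_nonneg_of_le (fun _ ↦ by positivity)
      fun u ↦ mul_le_mul_of_nonneg_left (hle u) (sq_nonneg _)
  have hmul {f g : L → ℝ} (hf : Summable f) (hg : Summable g) (hf0 : ∀ u, 0 ≤ f u)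
      (hg0 : ∀ u, 0 ≤ g u) :
      HasSum (fun p : L × L ↦ f p.1 * g p.2) ((∑' u, f u) * ∑' u, g u) := by
    have hs := hf.mul_of_nonneg hg hf0 hg0
    rw [hf.tsum_mul_tsum hg hs]
    exact hs.hasSum
  have e0 (u : L) : 0 ≤ exp (-Q u) := (exp_pos _).le
  have e0' (u : L) : 0 ≤ exp (-(Q u + r * D u ^ 2)) := (exp_pos _).le
  have x0 (u : L) : 0 ≤ X u ^ 2 * exp (-Q u) := by positivity
  have x0' (u : L) : 0 ≤ X u ^ 2 * exp (-(Q u + r * D u ^ 2)) := by positivity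
  have hF := (((hmul hX hw' x0 e0').sub (hmul hX' hw x0' e0)).sub
    (hmul hw hX' e0 x0')).add (hmul hw' hX e0' x0)
  set K : AddSubgroup L := (zsmulAddGroupHom (2 : ℤ) : L →+ L).range
  let b : L → ℝ := fun u ↦ X u * exp (-(Q u / 2 + r * D u ^ 2 / 4))
  let G : L × L → ℝ := fun p ↦
    if (p.1 : L ⧸ K) = p.2 then b p.1 * b p.2 * sinh (r / 2 * (D p.1 * D p.2)) else 0
  let m : L × L → L × L := fun p ↦ (p.1 + p.2, p.1 - p.2)
  have hm : Function.Injective m := by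
    rintro ⟨a, b⟩ ⟨c, d⟩ h
    simp only [m, Prod.mk.injEq] at h
    obtain ⟨h, h'⟩ := h
    have hac : a - c = 0 := h2 _ (by
      rw [show a - c + (a - c) = (a + b) + (a - b) - (c + c) by abel, h, h']; abel)
    have hac := sub_eq_zero.1 hac
    subst hac
    exact Prod.ext rfl (by simpa using h)
  have hsupp : Function.support G ⊆ Set.range m := by
    rintro ⟨u, v⟩ huv
    simp only [G, Function.mem_support, ne_eq, ite_eq_right_iff, Classical.not_imp] at huv
    obtain ⟨w, hw⟩ := QuotientAddGroup.eq.1 huv.1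
    have hw : (2 : ℤ) • w = -u + v := hw
    refine ⟨(u + w, -w), ?_⟩
    simp only [m, Prod.mk.injEq]
    constructor
    · abel
    · rw [show v = u + (-u + v) by abel, ← hw]; abel
  have hGm (p : L × L) : 2 * G (m p) =
      X p.1 ^ 2 * exp (-Q p.1) * exp (-(Q p.2 + r * D p.2 ^ 2)) -
          X p.1 ^ 2 * exp (-(Q p.1 + r * D p.1 ^ 2)) * exp (-Q p.2) -
        exp (-Q p.1) * (X p.2 ^ 2 * exp (-(Q p.2 + r * D p.2 ^ 2))) +
      exp (-(Q p.1 + r * D p.1 ^ 2)) * (X p.2 ^ 2 * exp (-Q p.2)) := by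
    obtain ⟨u, v⟩ := p
    have hmem : ((u + v : L) : L ⧸ K) = ((u - v : L) : L ⧸ K) := by
      refine QuotientAddGroup.eq.2 ⟨-v, ?_⟩
      simp only [zsmulAddGroupHom_apply]
      abel
    have hq := hQ u v
    have h1 : exp (-(Q (u + v) / 2 + r * D (u + v) ^ 2 / 4)) *
        exp (-(Q (u - v) / 2 + r * D (u - v) ^ 2 / 4)) =
        exp (-Q u) * exp (-Q v) * exp (-(r * (D u ^ 2 + D v ^ 2) / 2)) := by
      rw [← exp_add, ← exp_add, ← exp_add]
      congr 1
      rw [map_add, map_sub]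
      linarith
    have h3 (u : L) : exp (-(Q u + r * D u ^ 2)) = exp (-Q u) * exp (-(r * D u ^ 2)) := by
      rw [← exp_add]; congr 1; ring
    have h4 : exp (-(r * (D u ^ 2 + D v ^ 2) / 2)) *
        (2 * sinh (r / 2 * (D (u + v) * D (u - v)))) =
        exp (-(r * D v ^ 2)) - exp (-(r * D u ^ 2)) := by
      rw [sinh_eq, mul_div_cancel₀ _ two_ne_zero, mul_sub, ← exp_add, ← exp_add, map_add, map_sub]
      congr 2 <;> ring
    simp only [G, m, b, if_pos hmem]
    calc 2 * (X (u + v) * exp (-(Q (u + v) / 2 + r * D (u + v) ^ 2 / 4)) *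
          (X (u - v) * exp (-(Q (u - v) / 2 + r * D (u - v) ^ 2 / 4))) *
            sinh (r / 2 * (D (u + v) * D (u - v))))
        = X (u + v) * X (u - v) * (exp (-(Q (u + v) / 2 + r * D (u + v) ^ 2 / 4)) *
          exp (-(Q (u - v) / 2 + r * D (u - v) ^ 2 / 4))) *
            (2 * sinh (r / 2 * (D (u + v) * D (u - v)))) := by ring
      _ = (X u ^ 2 - X v ^ 2) * (exp (-Q u) * exp (-Q v)) *
          (exp (-(r * (D u ^ 2 + D v ^ 2) / 2)) *
            (2 * sinh (r / 2 * (D (u + v) * D (u - v))))) := by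
          rw [h1, map_add X, map_sub X]; ring
      _ = _ := by rw [h4, h3, h3]; ring
  have hGsum : Summable G := by
    rw [← hm.summable_iff fun x hx ↦ Function.notMem_support.1 fun h ↦ hx (hsupp h)]
    refine (hF.summable.mul_left (1 / 2)).congr fun p ↦ ?_
    rw [← hGm p]
    simp
  have hG0 : 0 ≤ ∑' p, G p := tsum_nonneg_of_sum_product_nonneg hGsum fun F ↦
    sum_sinh_kernel_nonneg (fun u : L ↦ (u : L ⧸ K)) b D (by positivity) F
  rw [← hm.tsum_eq hsupp] at hG0
  have := hF.tsum_eq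
  rw [← tsum_congr hGm, tsum_mul_left] at this
  nlinarith [this]

end GinibreInequality

section Resampling

open MeasureTheory Measure ProbabilityTheory

theorem measurable_update_prod {ι : Type*} [DecidableEq ι] (a : ι) :
    Measurable fun x : (ι → ℝ) × ℝ ↦ Function.update x.1 a x.2 := by
  refine measurable_pi_iff.2 fun i ↦ ?_
  by_cases h : i = a
  · subst h; simpa using measurable_snd
  · simp only [Function.update_of_ne h]; fun_prop

/-- Replacing one coordinate of an i.i.d. family by an independent copy preserves its law. -/
theorem map_update_prod_eq {ι : Type*} [DecidableEq ι] {μ : Measure ℝ} [IsProbabilityMeasure μ]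
    {P : Measure (ι → ℝ)} [IsProbabilityMeasure P]
    (hindep : iIndepFun (fun i (ω : ι → ℝ) ↦ ω i) P)
    (hmarg : ∀ i, P.map (fun ω ↦ ω i) = μ) (a : ι) :
    (P.prod μ).map (fun x ↦ Function.update x.1 a x.2) = P := by
  have hP : P = infinitePi fun _ : ι ↦ μ := by
    have h := (iIndepFun_iff_map_fun_eq_infinitePi_map (fun i ↦ measurable_pi_apply i)).1 hindep
    simpa [hmarg] using h
  rw [hP]
  refine eq_infinitePi _ fun s t ht ↦ ?_
  rw [map_apply (measurable_update_prod a) (.pi s.countable_toSet fun i _ ↦ ht i)]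
  have hset : (fun x : (ι → ℝ) × ℝ ↦ Function.update x.1 a x.2) ⁻¹' Set.pi s t =
      (Set.pi (s.erase a : Finset ι) t) ×ˢ (if a ∈ s then t a else Set.univ) := by
    ext ⟨l, x⟩
    simp only [Set.mem_preimage, Set.mem_pi, Finset.mem_coe, Set.mem_prod, Finset.mem_erase]
    constructor
    · intro h
      refine ⟨fun i hi ↦ by simpa [hi.1] using h i hi.2, ?_⟩
      split_ifs with ha
      · simpa using h a ha
      · trivial
    · rintro ⟨h, h'⟩ i hi
      by_cases hia : i = a
      · subst hia; simpa [hi] using h'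
      · simpa [hia] using h i ⟨hia, hi⟩
  rw [hset, prod_prod, infinitePi_pi _ fun i _ ↦ ht i]
  split_ifs with ha
  · rw [Finset.prod_erase_mul _ _ ha]
  · rw [measure_univ, mul_one, Finset.erase_eq_of_notMem ha]

theorem lintegral_eq_lintegral_update {ι : Type*} [DecidableEq ι] {μ : Measure ℝ}
    [IsProbabilityMeasure μ] {P : Measure (ι → ℝ)} [IsProbabilityMeasure P] {a : ι}
    (hres : (P.prod μ).map (fun x ↦ Function.update x.1 a x.2) = P)
    {f : (ι → ℝ) → ENNReal} (hf : Measurable f) :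
    ∫⁻ l, f l ∂P = ∫⁻ l, ∫⁻ t, f (Function.update l a t) ∂μ ∂P := by
  conv_lhs => rw [← hres]
  rw [lintegral_map hf (measurable_update_prod a),
    lintegral_prod]
  exact (hf.comp (measurable_update_prod a)).aemeasurable

/-- Chebyshev's association inequality. -/
theorem lintegral_mul_lintegral_le_of_antitoneOn {μ : Measure ℝ} [IsProbabilityMeasure μ]
    {f g : ℝ → ENNReal} (hf : Measurable f) (hg : Measurable g) {S : Set ℝ}
    (hS : ∀ᵐ t ∂μ, t ∈ S) (hfS : AntitoneOn f S) (hgS : AntitoneOn g S) :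
    (∫⁻ t, f t ∂μ) * ∫⁻ t, g t ∂μ ≤ ∫⁻ t, f t * g t ∂μ := by
  have hpt {s t : ℝ} (hs : s ∈ S) (ht : t ∈ S) :
      f s * g t + f t * g s ≤ f s * g s + f t * g t := by
    wlog hst : s ≤ t generalizing s t
    · have := this ht hs (le_of_not_ge hst)
      rwa [add_comm, add_comm (f s * g s)]
    obtain ⟨x, hx⟩ := exists_add_of_le (hfS hs ht hst)
    obtain ⟨y, hy⟩ := exists_add_of_le (hgS hs ht hst)
    rw [hx, hy]
    calc (f t + x) * g t + f t * (g t + y)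
        ≤ (f t + x) * g t + f t * (g t + y) + x * y := le_self_add
      _ = _ := by ring
  have hint : ∫⁻ s, ∫⁻ t, (f s * g t + f t * g s) ∂μ ∂μ ≤
      ∫⁻ s, ∫⁻ t, (f s * g s + f t * g t) ∂μ ∂μ := by
    refine lintegral_mono_ae ?_
    filter_upwards [hS] with s hs
    refine lintegral_mono_ae ?_
    filter_upwards [hS] with t ht using hpt hs ht
  have hL : ∫⁻ s, ∫⁻ t, (f s * g t + f t * g s) ∂μ ∂μ =
      2 * ((∫⁻ t, f t ∂μ) * ∫⁻ t, g t ∂μ) := by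
    have (s : ℝ) : ∫⁻ t, (f s * g t + f t * g s) ∂μ =
        f s * (∫⁻ t, g t ∂μ) + (∫⁻ t, f t ∂μ) * g s := by
      rw [lintegral_add_left (hg.const_mul _), lintegral_const_mul _ hg, lintegral_mul_const _ hf]
    simp_rw [this]
    rw [lintegral_add_left (hf.mul_const _), lintegral_mul_const _ hf, lintegral_const_mul _ hg]
    ring
  have hR : ∫⁻ s, ∫⁻ t, (f s * g s + f t * g t) ∂μ ∂μ = 2 * ∫⁻ t, f t * g t ∂μ := by
    have (s : ℝ) : ∫⁻ t, (f s * g s + f t * g t) ∂μ = f s * g s + ∫⁻ t, f t * g t ∂μ := by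
      rw [lintegral_add_left measurable_const, lintegral_const, measure_univ, mul_one]
    simp_rw [this]
    rw [lintegral_add_left (f := fun s ↦ f s * g s) (hf.mul hg), lintegral_const,
      measure_univ, mul_one, two_mul]
  rw [hL, hR] at hint
  exact (ENNReal.mul_le_mul_iff_right two_ne_zero ENNReal.ofNat_ne_top).1 hint

end Resampling

section RandomConductances

open MeasureTheory Measure ProbabilityTheory Filter Topology Real

variable {ι L : Type*} [AddCommGroup L]

/-- The Boltzmann weight `exp (-∑ₚ λₚ Dₚ²)`. -/
noncomputable def condWeight (D : ι → L →+ ℝ) (lam : ι → ℝ) (u : L) : ℝ :=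
  exp (-∑' p, lam p * D p u ^ 2)

/-- The second moment of `X` under the probability measure with weights `condWeight D lam`. -/
noncomputable def condSecondMoment (D : ι → L →+ ℝ) (X : L →+ ℝ) (lam : ι → ℝ) : ℝ :=
  (∑' u, X u ^ 2 * condWeight D lam u) / ∑' u, condWeight D lam u

/-- Nonnegative conductances for which the Gaussian measure with energy `∑ₚ λₚ Dₚ²` and the
second moment of `X` under it are given by convergent sums. -/
structure IsGoodConductance (D : ι → L →+ ℝ) (X : L →+ ℝ) (lam : ι → ℝ) : Prop where
  nonneg : ∀ p, 0 ≤ lam p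
  summable_energy : ∀ u, Summable fun p ↦ lam p * D p u ^ 2
  summable_weight : Summable (condWeight D lam)
  summable_sq_weight : Summable fun u ↦ X u ^ 2 * condWeight D lam u

theorem condWeight_pos (D : ι → L →+ ℝ) (lam : ι → ℝ) (u : L) : 0 < condWeight D lam u :=
  exp_pos _

theorem condSecondMoment_nonneg (D : ι → L →+ ℝ) (X : L →+ ℝ) (lam : ι → ℝ) :
    0 ≤ condSecondMoment D X lam :=
  div_nonneg (tsum_nonneg fun u ↦ mul_nonneg (sq_nonneg _) (condWeight_pos D lam u).le)
    (tsum_nonneg fun u ↦ (condWeight_pos D lam u).le)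

theorem measurable_condWeight [Countable ι] (D : ι → L →+ ℝ) (u : L) :
    Measurable fun lam ↦ condWeight D lam u := by
  unfold condWeight
  fun_prop

theorem measurable_condSecondMoment [Countable ι] [Countable L] (D : ι → L →+ ℝ) (X : L →+ ℝ) :
    Measurable (condSecondMoment D X) := by
  unfold condSecondMoment condWeight
  fun_prop

namespace IsGoodConductance

variable {D : ι → L →+ ℝ} {X : L →+ ℝ} {lam : ι → ℝ}

theorem tsum_condWeight_pos (h : IsGoodConductance D X lam) : 0 < ∑' u, condWeight D lam u :=
  h.summable_weight.tsum_pos (fun u ↦ (condWeight_pos D lam u).le) 0 (condWeight_pos D lam 0)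

theorem tsum_condWeight_mul_condSecondMoment (h : IsGoodConductance D X lam) :
    (∑' u, ENNReal.ofReal (condWeight D lam u)) * ENNReal.ofReal (condSecondMoment D X lam) =
      ∑' u, ENNReal.ofReal (X u ^ 2 * condWeight D lam u) := by
  have h0 (u : L) := (condWeight_pos D lam u).le
  rw [← ENNReal.ofReal_tsum_of_nonneg h0 h.summable_weight,
    ← ENNReal.ofReal_tsum_of_nonneg (fun u ↦ mul_nonneg (sq_nonneg _) (h0 u))
      h.summable_sq_weight,
    ← ENNReal.ofReal_mul (tsum_nonneg h0), condSecondMoment,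
    mul_div_cancel₀ _ h.tsum_condWeight_pos.ne']

theorem parallelogram (h : IsGoodConductance D X lam) (u v : L) :
    (∑' p, lam p * D p (u + v) ^ 2) + ∑' p, lam p * D p (u - v) ^ 2 =
      2 * (∑' p, lam p * D p u ^ 2) + 2 * ∑' p, lam p * D p v ^ 2 := by
  rw [← tsum_mul_left, ← tsum_mul_left, ← (h.summable_energy _).tsum_add (h.summable_energy _),
    ← ((h.summable_energy _).mul_left _).tsum_add ((h.summable_energy _).mul_left _)]
  refine tsum_congr fun p ↦ ?_
  rw [map_add, map_sub]
  ring

/-- Monotonicity of the second moment in a single conductance. -/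
theorem condSecondMoment_update_le [DecidableEq ι] (h2 : ∀ u : L, u + u = 0 → u = 0) {a : ι}
    {s t : ℝ} (hst : s ≤ t) (hs : IsGoodConductance D X (Function.update lam a s))
    (ht : IsGoodConductance D X (Function.update lam a t)) :
    condSecondMoment D X (Function.update lam a t) ≤
      condSecondMoment D X (Function.update lam a s) := by
  have hE (u : L) : ∑' p, Function.update lam a t p * D p u ^ 2 =
      (∑' p, Function.update lam a s p * D p u ^ 2) + (t - s) * D a u ^ 2 := by
    have hite := hasSum_ite_eq a ((t - s) * D a u ^ 2)
    rw [← hite.tsum_eq, ← (hs.summable_energy u).tsum_add hite.summable]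
    refine tsum_congr fun p ↦ ?_
    by_cases hp : p = a
    · subst hp; simp; ring
    · simp [hp]
  unfold condSecondMoment
  rw [div_le_div_iff₀ ht.tsum_condWeight_pos hs.tsum_condWeight_pos]
  unfold condWeight
  simp_rw [hE]
  exact second_moment_antitone h2 X (D a) _ hs.parallelogram (sub_nonneg.2 hst)
    hs.summable_weight hs.summable_sq_weight

end IsGoodConductance

theorem lintegral_exp_eq {μ : Measure ℝ} [IsProbabilityMeasure μ] (hμ : ∀ᵐ t ∂μ, 0 < t)
    {d k : ℝ} (hk : ∫ t, exp (-(t * d ^ 2)) ∂μ = exp (-k)) :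
    ∫⁻ t, ENNReal.ofReal (exp (-(t * d ^ 2))) ∂μ = ENNReal.ofReal (exp (-k)) ∧
      ∫⁻ t, ENNReal.ofReal (1 - exp (-(t * d ^ 2))) ∂μ = ENNReal.ofReal (1 - exp (-k)) := by
  have hint : Integrable (fun t ↦ exp (-(t * d ^ 2))) μ := by
    refine Integrable.of_bound (by fun_prop) 1 ?_
    filter_upwards [hμ] with t ht
    rw [norm_of_nonneg (exp_pos _).le]
    exact exp_le_one_iff.2 (neg_nonpos.2 (by positivity))
  constructor
  · rw [← hk, ofReal_integral_eq_lintegral_ofReal hint (.of_forall fun _ ↦ (exp_pos _).le)]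
  · have h1 : ∫ t, (1 - exp (-(t * d ^ 2))) ∂μ = 1 - exp (-k) := by
      rw [integral_sub (integrable_const _) hint, hk]
      simp
    rw [← h1, ofReal_integral_eq_lintegral_ofReal (f := fun t ↦ 1 - exp (-(t * d ^ 2)))
      ((integrable_const _).sub hint)]
    · filter_upwards [hμ] with t ht
      exact sub_nonneg.2 (exp_le_one_iff.2 (neg_nonpos.2 (by positivity)))

/-- Almost sure convergence of the random energy. -/
theorem ae_summable_energy [Countable ι] {μ : Measure ℝ} [IsProbabilityMeasure μ]
    (hμ : ∀ᵐ t ∂μ, 0 < t) {P : Measure (ι → ℝ)} (hmarg : ∀ i, P.map (fun ω ↦ ω i) = μ)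
    {d k : ι → ℝ} (hk : ∀ p, ∫ t, exp (-(t * d p ^ 2)) ∂μ = exp (-k p)) (hk0 : ∀ p, 0 ≤ k p)
    (hks : Summable k) : ∀ᵐ lam ∂P, Summable fun p ↦ lam p * d p ^ 2 := by
  have hpos : ∀ᵐ lam ∂P, ∀ p, 0 < lam p :=
    ae_all_iff.2 fun p ↦ ae_of_ae_map (f := fun ω : ι → ℝ ↦ ω p)
      (measurable_pi_apply p).aemeasurable
      ((hmarg p).symm ▸ hμ)
  have hmeas (p : ι) :
      Measurable fun lam : ι → ℝ ↦ ENNReal.ofReal (1 - exp (-(lam p * d p ^ 2))) := by fun_prop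
  have hfin : ∫⁻ lam, ∑' p, ENNReal.ofReal (1 - exp (-(lam p * d p ^ 2))) ∂P ≠ ⊤ := by
    rw [lintegral_tsum fun p ↦ (hmeas p).aemeasurable]
    have (p : ι) : ∫⁻ lam, ENNReal.ofReal (1 - exp (-(lam p * d p ^ 2))) ∂P ≤
        ENNReal.ofReal (k p) := by
      rw [← lintegral_map (μ := P) (g := fun lam : ι → ℝ ↦ lam p)
        (f := fun t ↦ ENNReal.ofReal (1 - exp (-(t * d p ^ 2)))) (by fun_prop) (by fun_prop),
        hmarg, (lintegral_exp_eq hμ (hk p)).2]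
      exact ENNReal.ofReal_le_ofReal (by linarith [one_sub_le_exp_neg (k p)])
    refine ne_top_of_le_ne_top ?_ (ENNReal.tsum_le_tsum this)
    rw [← ENNReal.ofReal_tsum_of_nonneg hk0 hks]
    exact ENNReal.ofReal_ne_top
  filter_upwards [hpos, ae_lt_top (Measurable.tsum hmeas) hfin] with lam hl hlt
  have h1 : Summable fun p ↦ 1 - exp (-(lam p * d p ^ 2)) := by
    refine (ENNReal.summable_toReal hlt.ne).congr fun p ↦ ENNReal.toReal_ofReal ?_
    have := hl p
    exact sub_nonneg.2 (exp_le_one_iff.2 (neg_nonpos.2 (by positivity)))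
  refine (summable_log_one_add_of_summable h1.neg).neg.congr fun p ↦ ?_
  rw [show 1 + -(1 - exp (-(lam p * d p ^ 2))) = exp (-(lam p * d p ^ 2)) by ring, log_exp,
    neg_neg]

theorem tendsto_prod_exp_neg {f : ι → ℝ} (hf : Summable f) :
    Tendsto (fun F : Finset ι ↦ ∏ p ∈ F, ENNReal.ofReal (exp (-f p))) atTop
      (𝓝 (ENNReal.ofReal (exp (-∑' p, f p)))) := by
  have (F : Finset ι) : ∏ p ∈ F, ENNReal.ofReal (exp (-f p)) =
      ENNReal.ofReal (exp (∑ p ∈ F, -f p)) := by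
    rw [← ENNReal.ofReal_prod_of_nonneg fun _ _ ↦ (exp_pos _).le, ← exp_sum]
  simp_rw [this]
  have hsum : Tendsto (fun F ↦ ∑ p ∈ F, -f p) atTop (𝓝 (-∑' p, f p)) := hf.hasSum.neg
  exact ENNReal.tendsto_ofReal ((continuous_exp.tendsto _).comp hsum)

section Annealed

variable {μ : Measure ℝ} [IsProbabilityMeasure μ] {P : Measure (ι → ℝ)} [IsProbabilityMeasure P]

theorem measurable_prod_exp (F : Finset ι) (d : ι → ℝ) :
    Measurable fun lam : ι → ℝ ↦ ∏ p ∈ F, ENNReal.ofReal (exp (-(lam p * d p ^ 2))) := by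
  fun_prop

theorem prod_exp_update [DecidableEq ι] {a : ι} {F : Finset ι} (ha : a ∉ F) (d : ι → ℝ)
    (lam : ι → ℝ) (t : ℝ) :
    ∏ p ∈ F, ENNReal.ofReal (exp (-(Function.update lam a t p * d p ^ 2))) =
      ∏ p ∈ F, ENNReal.ofReal (exp (-(lam p * d p ^ 2))) :=
  Finset.prod_congr rfl fun p hp ↦ by
    rw [Function.update_of_ne (ne_of_mem_of_not_mem hp ha)]

theorem lintegral_prod_exp [DecidableEq ι] (hμ : ∀ᵐ t ∂μ, 0 < t)
    (hres : ∀ a, (P.prod μ).map (fun x ↦ Function.update x.1 a x.2) = P) {d k : ι → ℝ}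
    (hk : ∀ p, ∫ t, exp (-(t * d p ^ 2)) ∂μ = exp (-k p)) (F : Finset ι) :
    ∫⁻ lam, ∏ p ∈ F, ENNReal.ofReal (exp (-(lam p * d p ^ 2))) ∂P =
      ∏ p ∈ F, ENNReal.ofReal (exp (-k p)) := by
  induction F using Finset.induction_on with
  | empty => simp
  | insert a F ha ih =>
    rw [lintegral_eq_lintegral_update (hres a) (measurable_prod_exp _ d), Finset.prod_insert ha,
      ← ih, ← (lintegral_exp_eq hμ (hk a)).1, ← lintegral_const_mul _ (measurable_prod_exp F d)]
    refine lintegral_congr fun lam ↦ ?_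
    simp_rw [Finset.prod_insert ha, prod_exp_update ha, Function.update_self]
    rw [lintegral_mul_const _ (by fun_prop)]

/-- A product of decreasing functions of finitely many independent coordinates is positively
correlated with any function decreasing in each coordinate. -/
theorem prod_mul_lintegral_le [DecidableEq ι] (hμ : ∀ᵐ t ∂μ, 0 < t)
    (hres : ∀ a, (P.prod μ).map (fun x ↦ Function.update x.1 a x.2) = P) {d k : ι → ℝ}
    (hk : ∀ p, ∫ t, exp (-(t * d p ^ 2)) ∂μ = exp (-k p)) {V : (ι → ℝ) → ENNReal}
    (hV : Measurable V) {S : Set (ι → ℝ)} (hS : ∀ᵐ lam ∂P, lam ∈ S)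
    (hVS : ∀ lam a s t, s ≤ t → Function.update lam a s ∈ S → Function.update lam a t ∈ S →
      V (Function.update lam a t) ≤ V (Function.update lam a s)) (F : Finset ι) :
    (∏ p ∈ F, ENNReal.ofReal (exp (-k p))) * ∫⁻ lam, V lam ∂P ≤
      ∫⁻ lam, (∏ p ∈ F, ENNReal.ofReal (exp (-(lam p * d p ^ 2)))) * V lam ∂P := by
  induction F using Finset.induction_on with
  | empty => simp
  | insert a F ha ih =>
    let G : (ι → ℝ) → ENNReal := fun lam ↦
      (∏ p ∈ F, ENNReal.ofReal (exp (-(lam p * d p ^ 2)))) * V lam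
    have hG : Measurable G := (measurable_prod_exp F d).mul hV
    have hae : ∀ᵐ lam ∂P, ∀ᵐ t ∂μ, Function.update lam a t ∈ S :=
      ae_ae_of_ae_prod (ae_of_ae_map (measurable_update_prod a).aemeasurable
        ((hres a).symm ▸ hS))
    calc (∏ p ∈ insert a F, ENNReal.ofReal (exp (-k p))) * ∫⁻ lam, V lam ∂P
        ≤ ENNReal.ofReal (exp (-k a)) * ∫⁻ lam, G lam ∂P := by
          rw [Finset.prod_insert ha, mul_assoc]
          gcongr
      _ = ∫⁻ lam, (∫⁻ t, ENNReal.ofReal (exp (-(t * d a ^ 2))) ∂μ) *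
            ∫⁻ t, G (Function.update lam a t) ∂μ ∂P := by
          rw [(lintegral_exp_eq hμ (hk a)).1, lintegral_const_mul,
            lintegral_eq_lintegral_update (hres a) hG]
          exact (hG.comp (measurable_update_prod a)).lintegral_prod_right'
      _ ≤ ∫⁻ lam, ∫⁻ t, ENNReal.ofReal (exp (-(t * d a ^ 2))) *
            G (Function.update lam a t) ∂μ ∂P := by
          refine lintegral_mono_ae ?_
          filter_upwards [hae] with lam hlam
          refine lintegral_mul_lintegral_le_of_antitoneOn (by fun_prop)
            (hG.comp (measurable_update lam)) hlam ?_ ?_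
          · intro s _ t _ hst
            exact ENNReal.ofReal_le_ofReal (exp_le_exp.2 (neg_le_neg (by gcongr)))
          · intro s hs t ht hst
            simp only [G, prod_exp_update ha]
            gcongr
            exact hVS lam a s t hst hs ht
      _ = _ := by
          have hm : Measurable fun lam ↦
              (∏ p ∈ insert a F, ENNReal.ofReal (exp (-(lam p * d p ^ 2)))) * V lam :=
            (measurable_prod_exp _ d).mul hV
          rw [lintegral_eq_lintegral_update (hres a) hm]
          simp only [G, Finset.prod_insert ha, Function.update_self, mul_assoc]

variable [Countable ι] {D : ι → L →+ ℝ} {X : L →+ ℝ} {k : ι → L → ℝ}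

theorem lintegral_condWeight_le (hμ : ∀ᵐ t ∂μ, 0 < t)
    (hindep : iIndepFun (fun i (ω : ι → ℝ) ↦ ω i) P)
    (hmarg : ∀ i, P.map (fun ω ↦ ω i) = μ)
    (hk : ∀ p u, ∫ t, exp (-(t * D p u ^ 2)) ∂μ = exp (-k p u)) (hk0 : ∀ p u, 0 ≤ k p u)
    (hks : ∀ u, Summable fun p ↦ k p u) (u : L) :
    ∫⁻ lam, ENNReal.ofReal (condWeight D lam u) ∂P ≤
      ENNReal.ofReal (exp (-∑' p, k p u)) := by
  classical
  have hpos : ∀ᵐ lam ∂P, ∀ p, 0 < lam p :=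
    ae_all_iff.2 fun p ↦ ae_of_ae_map (f := fun ω : ι → ℝ ↦ ω p)
      (measurable_pi_apply p).aemeasurable ((hmarg p).symm ▸ hμ)
  refine ge_of_tendsto' (tendsto_prod_exp_neg (hks u)) fun F ↦ ?_
  rw [← lintegral_prod_exp (d := fun p ↦ D p u) hμ
    (fun a ↦ map_update_prod_eq hindep hmarg a) (fun p ↦ hk p u)]
  refine lintegral_mono_ae ?_
  filter_upwards [hpos, ae_summable_energy hμ hmarg (fun p ↦ hk p u) (fun p ↦ hk0 p u) (hks u)]
    with lam hl hs
  rw [← ENNReal.ofReal_prod_of_nonneg fun _ _ ↦ (exp_pos _).le, ← exp_sum,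
    Finset.sum_neg_distrib]
  refine ENNReal.ofReal_le_ofReal (exp_le_exp.2 (neg_le_neg ?_))
  exact hs.sum_le_tsum F fun p _ ↦ mul_nonneg (hl p).le (sq_nonneg _)

variable [Countable L]

theorem ae_summable_mul_condWeight (hμ : ∀ᵐ t ∂μ, 0 < t)
    (hindep : iIndepFun (fun i (ω : ι → ℝ) ↦ ω i) P)
    (hmarg : ∀ i, P.map (fun ω ↦ ω i) = μ)
    (hk : ∀ p u, ∫ t, exp (-(t * D p u ^ 2)) ∂μ = exp (-k p u)) (hk0 : ∀ p u, 0 ≤ k p u)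
    (hks : ∀ u, Summable fun p ↦ k p u) {f : L → ℝ} (hf : ∀ u, 0 ≤ f u)
    (hfs : Summable fun u ↦ f u * exp (-∑' p, k p u)) :
    ∀ᵐ lam ∂P, Summable fun u ↦ f u * condWeight D lam u := by
  have hmeas (u : L) : Measurable fun lam ↦ ENNReal.ofReal (f u * condWeight D lam u) :=
    ((measurable_condWeight D u).const_mul _).ennreal_ofReal
  have hfin : ∫⁻ lam, ∑' u, ENNReal.ofReal (f u * condWeight D lam u) ∂P ≠ ⊤ := by
    rw [lintegral_tsum fun u ↦ (hmeas u).aemeasurable]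
    have (u : L) : ∫⁻ lam, ENNReal.ofReal (f u * condWeight D lam u) ∂P ≤
        ENNReal.ofReal (f u * exp (-∑' p, k p u)) := by
      simp_rw [ENNReal.ofReal_mul (hf u)]
      rw [lintegral_const_mul _ (measurable_condWeight D u).ennreal_ofReal]
      gcongr
      exact lintegral_condWeight_le hμ hindep hmarg hk hk0 hks u
    refine ne_top_of_le_ne_top ?_ (ENNReal.tsum_le_tsum this)
    rw [← ENNReal.ofReal_tsum_of_nonneg (fun u ↦ mul_nonneg (hf u) (exp_pos _).le) hfs]
    exact ENNReal.ofReal_ne_top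
  filter_upwards [ae_lt_top (Measurable.tsum hmeas) hfin] with lam hlam
  exact (ENNReal.summable_toReal hlam.ne).congr fun u ↦ ENNReal.toReal_ofReal
    (mul_nonneg (hf u) (condWeight_pos D lam u).le)

theorem ae_isGoodConductance (hμ : ∀ᵐ t ∂μ, 0 < t)
    (hindep : iIndepFun (fun i (ω : ι → ℝ) ↦ ω i) P)
    (hmarg : ∀ i, P.map (fun ω ↦ ω i) = μ)
    (hk : ∀ p u, ∫ t, exp (-(t * D p u ^ 2)) ∂μ = exp (-k p u)) (hk0 : ∀ p u, 0 ≤ k p u)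
    (hks : ∀ u, Summable fun p ↦ k p u) (hW : Summable fun u ↦ exp (-∑' p, k p u))
    (hXW : Summable fun u ↦ X u ^ 2 * exp (-∑' p, k p u)) :
    ∀ᵐ lam ∂P, IsGoodConductance D X lam := by
  have hpos : ∀ᵐ lam ∂P, ∀ p, 0 < lam p :=
    ae_all_iff.2 fun p ↦ ae_of_ae_map (f := fun ω : ι → ℝ ↦ ω p)
      (measurable_pi_apply p).aemeasurable ((hmarg p).symm ▸ hμ)
  filter_upwards [hpos, ae_all_iff.2 fun u ↦
      ae_summable_energy hμ hmarg (fun p ↦ hk p u) (fun p ↦ hk0 p u) (hks u),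
    ae_summable_mul_condWeight (f := fun _ ↦ 1) hμ hindep hmarg hk hk0 hks
      (fun _ ↦ zero_le_one) (by simpa using hW),
    ae_summable_mul_condWeight (f := fun u ↦ X u ^ 2) hμ hindep hmarg hk hk0 hks
      (fun _ ↦ sq_nonneg _) hXW] with lam h1 h2 h3 h4
  exact ⟨fun p ↦ (h1 p).le, h2, by simpa using h3, h4⟩

/-- The second moment under the annealed weights dominates the mean of the quenched second
moment. -/
theorem integral_condSecondMoment_le (h2 : ∀ u : L, u + u = 0 → u = 0) (hμ : ∀ᵐ t ∂μ, 0 < t)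
    (hindep : iIndepFun (fun i (ω : ι → ℝ) ↦ ω i) P)
    (hmarg : ∀ i, P.map (fun ω ↦ ω i) = μ)
    (hk : ∀ p u, ∫ t, exp (-(t * D p u ^ 2)) ∂μ = exp (-k p u)) (hk0 : ∀ p u, 0 ≤ k p u)
    (hks : ∀ u, Summable fun p ↦ k p u) (hW : Summable fun u ↦ exp (-∑' p, k p u))
    (hXW : Summable fun u ↦ X u ^ 2 * exp (-∑' p, k p u)) :
    ∫ lam, condSecondMoment D X lam ∂P ≤
      (∑' u, X u ^ 2 * exp (-∑' p, k p u)) / ∑' u, exp (-∑' p, k p u) := by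
  classical
  have hgood := ae_isGoodConductance (X := X) hμ hindep hmarg hk hk0 hks hW hXW
  have hmV := (measurable_condSecondMoment D X).ennreal_ofReal
  have hmw (u : L) := (measurable_condWeight D u).ennreal_ofReal
  have hRnonneg : 0 ≤ (∑' u, X u ^ 2 * exp (-∑' p, k p u)) / ∑' u, exp (-∑' p, k p u) :=
    div_nonneg (tsum_nonneg fun _ ↦ by positivity) (tsum_nonneg fun _ ↦ (exp_pos _).le)
  rw [integral_eq_lintegral_of_nonneg_ae (.of_forall (condSecondMoment_nonneg D X))
    (measurable_condSecondMoment D X).aestronglyMeasurable]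
  by_cases htop : ∫⁻ lam, ENNReal.ofReal (condSecondMoment D X lam) ∂P = ⊤
  · simpa [htop] using hRnonneg
  have hstep (u : L) : ENNReal.ofReal (exp (-∑' p, k p u)) *
      ∫⁻ lam, ENNReal.ofReal (condSecondMoment D X lam) ∂P ≤
      ∫⁻ lam, ENNReal.ofReal (condWeight D lam u) *
        ENNReal.ofReal (condSecondMoment D X lam) ∂P := by
    have hl : Tendsto (fun F : Finset ι ↦ (∏ p ∈ F, ENNReal.ofReal (exp (-k p u))) *
        ∫⁻ lam, ENNReal.ofReal (condSecondMoment D X lam) ∂P) atTop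
        (𝓝 (ENNReal.ofReal (exp (-∑' p, k p u)) *
          ∫⁻ lam, ENNReal.ofReal (condSecondMoment D X lam) ∂P)) :=
      ENNReal.Tendsto.mul_const (tendsto_prod_exp_neg (hks u)) (.inr htop)
    have hr : Tendsto (fun F : Finset ι ↦
        ∫⁻ lam, (∏ p ∈ F, ENNReal.ofReal (exp (-(lam p * D p u ^ 2)))) *
          ENNReal.ofReal (condSecondMoment D X lam) ∂P) atTop
        (𝓝 (∫⁻ lam, ENNReal.ofReal (condWeight D lam u) *
          ENNReal.ofReal (condSecondMoment D X lam) ∂P)) := by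
      refine tendsto_lintegral_filter_of_dominated_convergence
        (fun lam ↦ ENNReal.ofReal (condSecondMoment D X lam))
        (.of_forall fun F ↦ (measurable_prod_exp F fun p ↦ D p u).mul hmV)
        (.of_forall fun F ↦ ?_) htop ?_
      · filter_upwards [hgood] with lam hlam
        refine mul_le_of_le_one_left' (Finset.prod_le_one' fun p _ ↦ ?_)
        exact ENNReal.ofReal_le_one.2 (exp_le_one_iff.2
          (neg_nonpos.2 (mul_nonneg (hlam.nonneg p) (sq_nonneg _))))
      · filter_upwards [hgood] with lam hlam
        exact ENNReal.Tendsto.mul_const (tendsto_prod_exp_neg (hlam.summable_energy u))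
          (.inr ENNReal.ofReal_ne_top)
    refine le_of_tendsto_of_tendsto' hl hr fun F ↦ ?_
    refine prod_mul_lintegral_le (d := fun p ↦ D p u) hμ
      (fun a ↦ map_update_prod_eq hindep hmarg a) (fun p ↦ hk p u) hmV hgood ?_ F
    exact fun lam a s t hst hs ht ↦
      ENNReal.ofReal_le_ofReal (hs.condSecondMoment_update_le h2 hst ht)
  have hsum : ENNReal.ofReal (∑' u, exp (-∑' p, k p u)) *
      ∫⁻ lam, ENNReal.ofReal (condSecondMoment D X lam) ∂P ≤
      ENNReal.ofReal (∑' u, X u ^ 2 * exp (-∑' p, k p u)) := by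
    calc ENNReal.ofReal (∑' u, exp (-∑' p, k p u)) *
          ∫⁻ lam, ENNReal.ofReal (condSecondMoment D X lam) ∂P
        ≤ ∑' u, ∫⁻ lam, ENNReal.ofReal (condWeight D lam u) *
            ENNReal.ofReal (condSecondMoment D X lam) ∂P := by
          rw [ENNReal.ofReal_tsum_of_nonneg (fun _ ↦ (exp_pos _).le) hW, ← ENNReal.tsum_mul_right]
          exact ENNReal.tsum_le_tsum hstep
      _ = ∫⁻ lam, ∑' u, ENNReal.ofReal (X u ^ 2 * condWeight D lam u) ∂P := by
          have hm (u : L) : Measurable fun lam ↦ ENNReal.ofReal (condWeight D lam u) *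
              ENNReal.ofReal (condSecondMoment D X lam) := (hmw u).mul hmV
          rw [← lintegral_tsum fun u ↦ (hm u).aemeasurable]
          refine lintegral_congr_ae ?_
          filter_upwards [hgood] with lam hlam
          rw [ENNReal.tsum_mul_right, hlam.tsum_condWeight_mul_condSecondMoment]
      _ = ∑' u, ENNReal.ofReal (X u ^ 2) * ∫⁻ lam, ENNReal.ofReal (condWeight D lam u) ∂P := by
          simp_rw [ENNReal.ofReal_mul (sq_nonneg _)]
          rw [lintegral_tsum fun u ↦ ((hmw u).const_mul _).aemeasurable]
          exact tsum_congr fun u ↦ lintegral_const_mul _ (hmw u)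
      _ ≤ ∑' u, ENNReal.ofReal (X u ^ 2) * ENNReal.ofReal (exp (-∑' p, k p u)) :=
          ENNReal.tsum_le_tsum fun u ↦ by
            gcongr
            exact lintegral_condWeight_le hμ hindep hmarg hk hk0 hks u
      _ = _ := by
          rw [ENNReal.ofReal_tsum_of_nonneg (fun _ ↦ by positivity) hXW]
          exact tsum_congr fun u ↦ (ENNReal.ofReal_mul (sq_nonneg _)).symm
  have hZ : 0 < ∑' u, exp (-∑' p, k p u) :=
    hW.tsum_pos (fun _ ↦ (exp_pos _).le) 0 (exp_pos _)
  rw [le_div_iff₀ hZ, mul_comm]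
  have := ENNReal.toReal_mono ENNReal.ofReal_ne_top hsum
  rwa [ENNReal.toReal_mul, ENNReal.toReal_ofReal hZ.le,
    ENNReal.toReal_ofReal (tsum_nonneg fun _ ↦ by positivity)] at this

end Annealed

end RandomConductances

section ChainConfig

open Real MeasureTheory

/-- Configurations of the chain of length `N` as a subgroup of `ℤ → ℤ`. -/
def chainSubgroup (N : ℕ) : AddSubgroup (ℤ → ℤ) where
  carrier := {φ | ∀ k : ℤ, (N : ℤ) < |k| → φ k = 0}
  add_mem' hφ hψ k hk := by simp [hφ k hk, hψ k hk]
  zero_mem' _ _ := rfl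
  neg_mem' hφ k hk := by simp [hφ k hk]

instance (N : ℕ) : AddCommGroup (ChainConfig N) :=
  inferInstanceAs (AddCommGroup (chainSubgroup N))

theorem ChainConfig.restrict_injective (N : ℕ) :
    Function.Injective fun (φ : ChainConfig N) (i : Finset.Icc (-(N : ℤ)) N) ↦ φ.val i := by
  intro φ ψ h
  refine Subtype.ext (funext fun k ↦ ?_)
  by_cases hk : (N : ℤ) < |k|
  · rw [φ.2 k hk, ψ.2 k hk]
  · exact congrFun h ⟨k, Finset.mem_Icc.2 (abs_le.1 (not_lt.1 hk))⟩

instance (N : ℕ) : Countable (ChainConfig N) :=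
  (ChainConfig.restrict_injective N).countable

theorem ChainConfig.eq_zero_of_add_self {N : ℕ} (φ : ChainConfig N) (h : φ + φ = 0) : φ = 0 := by
  refine Subtype.ext (funext fun k ↦ ?_)
  have hk : φ.val k + φ.val k = 0 := congrFun (congrArg Subtype.val h) k
  change φ.val k = 0
  lia

/-- The height at site `k`. -/
def ChainConfig.height (N : ℕ) (k : ℤ) : ChainConfig N →+ ℝ where
  toFun φ := (φ.val k : ℝ)
  map_zero' := Int.cast_zero
  map_add' _ _ := Int.cast_add _ _

theorem ChainConfig.tsum_odd_eq_zero {N : ℕ} {w : (ℤ → ℤ) → ℝ} (hw : ∀ φ, w (-φ) = w φ) :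
    ∑' φ : ChainConfig N, ((φ.val 0 : ℤ) : ℝ) * w φ.val = 0 := by
  have h := (Equiv.neg (ChainConfig N)).tsum_eq fun φ ↦ ((φ.val 0 : ℤ) : ℝ) * w φ.val
  have hneg (φ : ChainConfig N) : ((((Equiv.neg _) φ).val 0 : ℤ) : ℝ) *
      w (((Equiv.neg (ChainConfig N)) φ).val) = -(((φ.val 0 : ℤ) : ℝ) * w φ.val) := by
    change (((-φ.val) 0 : ℤ) : ℝ) * w (-φ.val) = _
    rw [hw, Pi.neg_apply, Int.cast_neg, neg_mul]
  rw [tsum_congr hneg, tsum_neg] at h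
  linarith

theorem chainMean_eq_zero (N : ℕ) (β α q : ℝ) : chainMean N β α q = 0 := by
  rw [chainMean, ChainConfig.tsum_odd_eq_zero, zero_div]
  intro φ
  simp only [chainWeight, chainEnergy, Pi.neg_apply]
  congr 4
  refine funext fun p ↦ ?_
  rw [← abs_neg, ← Int.cast_neg, show -(-φ p.1 - -φ p.2) = φ p.1 - φ p.2 by ring]

theorem qchainMean_eq_zero (N : ℕ) (β α : ℝ) (lam : ℤ × ℤ → ℝ) : qchainMean N β α lam = 0 := by
  rw [qchainMean, ChainConfig.tsum_odd_eq_zero, zero_div]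
  intro φ
  simp only [qchainWeight, qchainEnergy, Pi.neg_apply]
  congr 4
  refine funext fun p ↦ ?_
  rw [← neg_sq, ← Int.cast_neg, show -(-φ p.1 - -φ p.2) = φ p.1 - φ p.2 by ring]

theorem summable_prod_apply {ι κ : Type*} [Fintype ι] {g : κ → ℝ} (hg : Summable g)
    (hg0 : ∀ n, 0 ≤ g n) : Summable fun u : ι → κ ↦ ∏ i, g (u i) := by
  classical
  refine summable_of_sum_le (c := ∏ _i : ι, ∑' n, g n)
    (fun u ↦ Finset.prod_nonneg fun i _ ↦ hg0 _) fun s ↦ ?_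
  calc ∑ u ∈ s, ∏ i, g (u i)
      ≤ ∑ u ∈ Fintype.piFinset fun i ↦ s.image fun u ↦ u i, ∏ i, g (u i) := by
        refine Finset.sum_le_sum_of_subset_of_nonneg (fun u hu ↦ ?_)
          fun u _ _ ↦ Finset.prod_nonneg fun i _ ↦ hg0 _
        exact Fintype.mem_piFinset.2 fun i ↦ Finset.mem_image_of_mem _ hu
    _ = ∏ i, ∑ n ∈ s.image fun u ↦ u i, g n :=
        (Finset.prod_univ_sum _ _).symm
    _ ≤ ∏ _i : ι, ∑' n, g n :=
        Finset.prod_le_prod (fun _ _ ↦ Finset.sum_nonneg fun _ _ ↦ hg0 _)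
          fun _ _ ↦ hg.sum_le_tsum _ fun _ _ ↦ hg0 _

theorem summable_one_add_sq_mul_exp_neg {c q : ℝ} (hc : 0 < c) (hq : 0 < q) :
    Summable fun n : ℤ ↦ (1 + (n : ℝ) ^ 2) * exp (-(c * |(n : ℝ)| ^ q)) := by
  obtain ⟨m, hm⟩ := exists_nat_ge (4 / q)
  have hqm : 4 ≤ q * m := by rwa [div_le_iff₀' hq] at hm
  have hs : Summable fun n : ℤ ↦ 2 * (m.factorial / c ^ m) * |(n : ℝ)| ^ (-2 : ℝ) +
      if n = 0 then 1 else 0 :=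
    ((summable_abs_int_rpow one_lt_two).mul_left _).add (hasSum_ite_eq 0 1).summable
  refine hs.of_nonneg_of_le (fun n ↦ by positivity) fun n ↦ ?_
  by_cases hn : n = 0
  · subst hn
    simp [zero_rpow hq.ne']
  have hn1 : (1 : ℝ) ≤ |(n : ℝ)| := by exact_mod_cast Int.one_le_abs hn
  set x := |(n : ℝ)|
  have hx : 0 < x := by linarith
  rw [if_neg hn, add_zero, ← sq_abs (n : ℝ)]
  have he : c ^ m * x ^ 4 / m.factorial ≤ exp (c * x ^ q) := by
    refine le_trans ?_ (pow_div_factorial_le_exp (c * x ^ q) (by positivity) m)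
    rw [mul_pow, ← rpow_natCast (x ^ q), ← rpow_mul hx.le]
    gcongr
    rw [← rpow_natCast]
    exact rpow_le_rpow_of_exponent_le hn1 (by exact_mod_cast hqm)
  rw [exp_neg, rpow_neg hx.le, rpow_two]
  calc (1 + x ^ 2) * (exp (c * x ^ q))⁻¹
      ≤ (2 * x ^ 2) * (c ^ m * x ^ 4 / m.factorial)⁻¹ := by
        gcongr
        nlinarith
    _ = _ := by field_simp

theorem summable_interaction {α : ℝ} (hα : 1 < α) (β : ℝ) {q : ℝ} (hq : 0 < q) {N : ℕ}
    (φ : ChainConfig N) :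
    Summable fun p : ℤ × ℤ ↦
      β * (|((φ.val p.1 - φ.val p.2 : ℤ) : ℝ)| ^ q / |((p.1 - p.2 : ℤ) : ℝ)| ^ α) := by
  refine Summable.mul_left _ ?_
  set B : ℝ := ∑ a ∈ Finset.Icc (-(N : ℤ)) N, |(φ.val a : ℝ)|
  have hB (i : ℤ) : |(φ.val i : ℝ)| ≤ B := by
    by_cases hi : i ∈ Finset.Icc (-(N : ℤ)) N
    · exact Finset.single_le_sum (f := fun a ↦ |(φ.val a : ℝ)|) (fun _ _ ↦ abs_nonneg _) hi
    · have : φ.val i = 0 := φ.2 i (not_le.1 fun h ↦ hi (Finset.mem_Icc.2 (abs_le.1 h)))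
      rw [this, Int.cast_zero, abs_zero]
      exact Finset.sum_nonneg fun _ _ ↦ abs_nonneg _
  have hrow : Summable fun p : ℤ × ℤ ↦ ∑ a ∈ Finset.Icc (-(N : ℤ)) N,
      if p.1 = a then |((p.1 - p.2 : ℤ) : ℝ)| ^ (-α) else 0 := by
    refine summable_sum fun a _ ↦ ?_
    have hinj : Function.Injective fun n : ℤ ↦ (a, a - n) := fun m n h ↦ by simpa using h
    rw [← hinj.summable_iff]
    · simpa [Function.comp_def] using summable_abs_int_rpow hα
    · rintro ⟨i, j⟩ hij
      refine if_neg fun hi ↦ hij ⟨a - j, ?_⟩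
      simpa using hi.symm
  have hcol := hrow.comp_injective (Prod.swap_injective (α := ℤ) (β := ℤ))
  refine ((hrow.add hcol).mul_left ((2 * B) ^ q)).of_nonneg_of_le (fun _ ↦ by positivity) ?_
  rintro ⟨i, j⟩
  have hB0 : 0 ≤ B := (abs_nonneg _).trans (hB 0)
  have hij : |((i - j : ℤ) : ℝ)| ^ (-α) = |((j - i : ℤ) : ℝ)| ^ (-α) := by
    rw [← abs_neg, ← Int.cast_neg, neg_sub]
  simp only [Function.comp_apply, Prod.swap_prod_mk, Finset.sum_ite_eq, ← hij]
  have h0 : 0 ≤ |((i - j : ℤ) : ℝ)| ^ (-α) := by positivity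
  by_cases hmem : i ∈ Finset.Icc (-(N : ℤ)) N ∨ j ∈ Finset.Icc (-(N : ℤ)) N
  · have hle : |((φ.val i - φ.val j : ℤ) : ℝ)| ≤ 2 * B := by
      rw [Int.cast_sub]
      linarith [abs_sub (φ.val i : ℝ) (φ.val j), hB i, hB j]
    rw [div_eq_mul_inv, ← rpow_neg (abs_nonneg _)]
    gcongr
    rcases hmem with h | h <;> rw [if_pos h]
    · exact le_add_of_nonneg_right (by split_ifs; exacts [h0, le_rfl])
    · exact le_add_of_nonneg_left (by split_ifs; exacts [h0, le_rfl])
  · rw [not_or] at hmem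
    have hz (k : ℤ) (hk : k ∉ Finset.Icc (-(N : ℤ)) N) : φ.val k = 0 :=
      φ.2 k (not_le.1 fun h ↦ hk (Finset.mem_Icc.2 (abs_le.1 h)))
    rw [hz i hmem.1, hz j hmem.2, if_neg hmem.1, if_neg hmem.2]
    simp [zero_rpow hq.ne']

theorem sum_rpow_le_tsum_interaction {α β q : ℝ} (hα : 1 < α) (hβ : 0 < β) (hq : 0 < q) {N : ℕ}
    (φ : ChainConfig N) :
    ∑ i : Finset.Icc (-(N : ℤ)) N, β / (2 * N + 1) ^ α * |(φ.val i : ℝ)| ^ q ≤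
      ∑' p : ℤ × ℤ,
        β * (|((φ.val p.1 - φ.val p.2 : ℤ) : ℝ)| ^ q / |((p.1 - p.2 : ℤ) : ℝ)| ^ α) := by
  have h := (summable_interaction hα β hq φ).sum_le_tsum
    (Finset.Icc (-(N : ℤ)) N ×ˢ {(N : ℤ) + 1}) fun _ _ ↦ by positivity
  refine le_trans ?_ h
  rw [Finset.sum_product, Finset.sum_coe_sort (Finset.Icc (-(N : ℤ)) N)
    fun i ↦ β / (2 * N + 1) ^ α * |(φ.val i : ℝ)| ^ q]
  refine Finset.sum_le_sum fun i hi ↦ ?_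
  obtain ⟨h1, h2⟩ := Finset.mem_Icc.1 hi
  have hN : φ.val ((N : ℤ) + 1) = 0 := φ.2 _ (lt_of_lt_of_le (lt_add_one _) (le_abs_self _))
  have hd : |((i - ((N : ℤ) + 1) : ℤ) : ℝ)| ≤ 2 * N + 1 := by
    rw [← Int.cast_abs]
    have : |i - ((N : ℤ) + 1)| ≤ 2 * N + 1 := abs_le.2 ⟨by lia, by lia⟩
    exact_mod_cast this
  have hd0 : 0 < |((i - ((N : ℤ) + 1) : ℤ) : ℝ)| :=
    abs_pos.2 (Int.cast_ne_zero.2 (by lia))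
  rw [Finset.sum_singleton]
  dsimp only
  rw [hN, sub_zero, div_mul_eq_mul_div, mul_div_assoc]
  gcongr

theorem summable_one_add_sq_mul_exp_neg_interaction {α β q : ℝ} (hα : 1 < α) (hβ : 0 < β)
    (hq : 0 < q) (N : ℕ) :
    Summable fun φ : ChainConfig N ↦ (1 + (φ.val 0 : ℝ) ^ 2) * exp (-∑' p : ℤ × ℤ,
      β * (|((φ.val p.1 - φ.val p.2 : ℤ) : ℝ)| ^ q / |((p.1 - p.2 : ℤ) : ℝ)| ^ α)) := by
  have hc : 0 < β / (2 * N + 1) ^ α := by positivity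
  have hs := (summable_prod_apply (ι := Finset.Icc (-(N : ℤ)) N)
    (summable_one_add_sq_mul_exp_neg hc hq) fun n ↦ by positivity).comp_injective
      (ChainConfig.restrict_injective N)
  refine hs.of_nonneg_of_le (fun _ ↦ by positivity) fun φ ↦ ?_
  simp only [Function.comp_apply]
  rw [Finset.prod_mul_distrib, ← exp_sum, Finset.sum_neg_distrib]
  gcongr
  · have h0 : (0 : ℤ) ∈ Finset.Icc (-(N : ℤ)) N := Finset.mem_Icc.2 ⟨by lia, by lia⟩
    rw [← Finset.mul_prod_erase _ _ (Finset.mem_univ (⟨0, h0⟩ : Finset.Icc (-(N : ℤ)) N))]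
    refine le_mul_of_one_le_right (by positivity) ?_
    exact Finset.one_le_prod fun i _ ↦ le_add_of_nonneg_right (sq_nonneg _)
  · exact sum_rpow_le_tsum_interaction hα hβ hq φ

/-- The discrete gradient along a pair of sites, normalized so that the `q`-th power of its
absolute value is the interaction of the `q`-SOS chain. -/
noncomputable def chainGradient (N : ℕ) (β α q : ℝ) (p : ℤ × ℤ) : ChainConfig N →+ ℝ :=
  (AddMonoidHom.mulLeft (β ^ (1 / q) / |((p.1 - p.2 : ℤ) : ℝ)| ^ (α / q))).comp
    (ChainConfig.height N p.1 - ChainConfig.height N p.2)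

theorem chainGradient_apply {N : ℕ} (β α q : ℝ) (p : ℤ × ℤ) (φ : ChainConfig N) :
    chainGradient N β α q p φ = β ^ (1 / q) / |((p.1 - p.2 : ℤ) : ℝ)| ^ (α / q) *
      ((φ.val p.1 - φ.val p.2 : ℤ) : ℝ) := by
  rw [Int.cast_sub (φ.val p.1)]
  rfl

theorem abs_chainGradient_rpow {N : ℕ} {β α q : ℝ} (hβ : 0 < β) (hq : 0 < q) (p : ℤ × ℤ)
    (φ : ChainConfig N) :
    |chainGradient N β α q p φ| ^ q =
      β * (|((φ.val p.1 - φ.val p.2 : ℤ) : ℝ)| ^ q / |((p.1 - p.2 : ℤ) : ℝ)| ^ α) := by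
  rw [chainGradient_apply, abs_mul, abs_of_nonneg (by positivity),
    mul_rpow (by positivity) (abs_nonneg _), div_rpow (by positivity) (by positivity),
    ← rpow_mul hβ.le, ← rpow_mul (abs_nonneg _), one_div, inv_mul_cancel₀ hq.ne', rpow_one,
    div_mul_cancel₀ _ hq.ne']
  ring

theorem chainGradient_sq {N : ℕ} {β α q : ℝ} (hβ : 0 < β) (p : ℤ × ℤ) (φ : ChainConfig N) :
    chainGradient N β α q p φ ^ 2 = β ^ ((2 : ℝ) / q) *
      (((φ.val p.1 - φ.val p.2 : ℤ) : ℝ) ^ 2 / |((p.1 - p.2 : ℤ) : ℝ)| ^ (2 * α / q)) := by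
  rw [chainGradient_apply, mul_pow, div_pow, ← rpow_natCast (β ^ (1 / q)),
    ← rpow_natCast (_ ^ (α / q)), ← rpow_mul hβ.le, ← rpow_mul (abs_nonneg _),
    show 1 / q * ((2 : ℕ) : ℝ) = 2 / q by push_cast; ring,
    show α / q * ((2 : ℕ) : ℝ) = 2 * α / q by push_cast; ring]
  ring

theorem chainWeight_eq {q : ℝ} (hq : 0 < q) (β α : ℝ) {N : ℕ} (φ : ChainConfig N) :
    chainWeight β α q φ.val = exp (-∑' p : ℤ × ℤ,
      β * (|((φ.val p.1 - φ.val p.2 : ℤ) : ℝ)| ^ q / |((p.1 - p.2 : ℤ) : ℝ)| ^ α)) := by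
  rw [chainWeight, chainEnergy, ← tsum_mul_left]
  congr 2
  refine tsum_congr fun p ↦ ?_
  split_ifs with h
  · simp [h, zero_rpow hq.ne']
  · rfl

theorem qchainWeight_eq {β : ℝ} (hβ : 0 < β) (α q : ℝ) (lam : ℤ × ℤ → ℝ) {N : ℕ}
    (φ : ChainConfig N) :
    qchainWeight (β ^ ((2 : ℝ) / q)) (2 * α / q) lam φ.val =
      condWeight (chainGradient N β α q) lam φ := by
  rw [qchainWeight, qchainEnergy, ← tsum_mul_left, condWeight]
  congr 2
  refine tsum_congr fun p ↦ ?_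
  rw [chainGradient_sq hβ]
  split_ifs with h
  · simp [h]
  · ring

theorem qchainVar_eq {β : ℝ} (hβ : 0 < β) (α q : ℝ) (lam : ℤ × ℤ → ℝ) (N : ℕ) :
    qchainVar N (β ^ ((2 : ℝ) / q)) (2 * α / q) lam =
      condSecondMoment (chainGradient N β α q) (ChainConfig.height N 0) lam := by
  rw [qchainVar, qchainMean_eq_zero, qchainZ, condSecondMoment, zero_pow two_ne_zero, sub_zero]
  simp_rw [qchainWeight_eq hβ]
  rfl

theorem chainVar_eq {β q : ℝ} (hβ : 0 < β) (hq : 0 < q) (α : ℝ) (N : ℕ) :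
    chainVar N β α q =
      (∑' φ : ChainConfig N, ChainConfig.height N 0 φ ^ 2 *
        exp (-∑' p, |chainGradient N β α q p φ| ^ q)) /
      ∑' φ : ChainConfig N, exp (-∑' p, |chainGradient N β α q p φ| ^ q) := by
  rw [chainVar, chainMean_eq_zero, chainZ, zero_pow two_ne_zero, sub_zero]
  simp_rw [chainWeight_eq hq, abs_chainGradient_rpow hβ hq]
  rfl

end ChainConfig

open MeasureTheory

/-- **Domination of the `q`-SOS chain from below by an annealed Gaussian chain with
i.i.d. random conductances.** Fix `q ∈ (0,2]`, `β ∈ (0,∞)`, `α ∈ (1,∞)`, and set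
`β_q := β^{2/q}` and `α_q := 2α/q`. Let `μ_q` be the Gaussian mixing measure of the
potential `e^{−|x|^q}` and let `P` be the law of i.i.d. conductances `(λ_{ij})_{i,j∈ℤ}`
with marginal `μ_q`. Then for every `N ≥ 1`,
`Var^{q-SOS}_{N,β,α}[φ(0)] ≥ E_q[Var^λ_{N,β_q,α_q}[φ(0)]]`. -/
theorem qSOS_dominates_annealed_gaussian_chain
    (q : ℝ) (hq₀ : 0 < q) (hq₂ : q ≤ 2)
    (β : ℝ) (hβ : 0 < β) (α : ℝ) (hα : 1 < α)
    (μq : Measure ℝ) (hμprob : IsProbabilityMeasure μq)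
    (hμsupp : μq {l : ℝ | l ≤ 0} = 0)
    (hμmix : ∀ x : ℝ, Real.exp (-(|x| ^ q)) = ∫ l, Real.exp (-(l * x ^ 2)) ∂μq)
    (P : Measure ((ℤ × ℤ) → ℝ)) (hPprob : IsProbabilityMeasure P)
    (hPindep : ProbabilityTheory.iIndepFun
      (m := fun _ : ℤ × ℤ => (inferInstance : MeasurableSpace ℝ)) (fun ij ω => ω ij) P)
    (hPmarg : ∀ ij : ℤ × ℤ, P.map (fun ω => ω ij) = μq)
    (N : ℕ) (hN : 1 ≤ N) :
    ∫ lam, qchainVar N (β ^ ((2 : ℝ) / q)) (2 * α / q) lam ∂P ≤ chainVar N β α q := by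
  have hμ : ∀ᵐ t ∂μq, 0 < t := by
    rw [ae_iff]
    simpa using hμsupp
  have hS : Summable fun φ : ChainConfig N ↦ (1 + ChainConfig.height N 0 φ ^ 2) *
      Real.exp (-∑' p, |chainGradient N β α q p φ| ^ q) := by
    simp_rw [abs_chainGradient_rpow hβ hq₀]
    exact summable_one_add_sq_mul_exp_neg_interaction hα hβ hq₀ N
  simp_rw [qchainVar_eq hβ]
  rw [chainVar_eq hβ hq₀]
  refine integral_condSecondMoment_le (D := chainGradient N β α q) (X := ChainConfig.height N 0)
    (k := fun p φ ↦ |chainGradient N β α q p φ| ^ q) ChainConfig.eq_zero_of_add_self hμ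
    hPindep hPmarg (fun p φ ↦ (hμmix _).symm) (fun p φ ↦ Real.rpow_nonneg (abs_nonneg _) _)
    (fun φ ↦ ?_) ?_ ?_
  · simp_rw [abs_chainGradient_rpow hβ hq₀]
    exact summable_interaction hα β hq₀ φ
  · refine hS.of_nonneg_of_le (fun _ ↦ (Real.exp_pos _).le) fun φ ↦ ?_
    exact le_mul_of_one_le_left (Real.exp_pos _).le (le_add_of_nonneg_right (sq_nonneg _))
  · refine hS.of_nonneg_of_le (fun _ ↦ mul_nonneg (sq_nonneg _) (Real.exp_pos _).le) fun φ ↦ ?_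
    exact mul_le_mul_of_nonneg_right (le_add_of_nonneg_left zero_le_one) (Real.exp_pos _).le
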